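/- arXiv:2112.06236 — 2 statements merged into one kernel-verified Lean document; each statement's English description precedes it below -/
import Mathlib

section
/- Let G be a finite group, H a subgroup of G, and A a normal subgroup of G with H ≤ A ≤ G. If A is a perfect code of the pair (G,H), then for every x ∈ G with x² ∈ A there exists b ∈ A such that (xb)² ∈ H. -/
open scoped Pointwise

/-- A perfect code in a graph: an independent set `C` of vertices such that every
vertex outside of `C` is adjacent to exactly one vertex in `C`. -/
def IsPerfectCode {V : Type*} (Γ : SimpleGraph V) (C : Set V) : Prop :=
  (∀ a ∈ C, ∀ b ∈ C, ¬ Γ.Adj a b) ∧ ∀ v ∉ C, ∃! c, c ∈ C ∧ Γ.Adj v c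

/-- A total perfect code in a graph: a set `C` of vertices such that every vertex
of the graph is adjacent to exactly one vertex in `C`. -/
def IsTotalPerfectCode {V : Type*} (Γ : SimpleGraph V) (C : Set V) : Prop :=
  ∀ v, ∃! c, c ∈ C ∧ Γ.Adj v c

/-- The coset graph `Cos(G,H,U)`: vertices are the left cosets of `H` in `G`, and
`g₁H` is adjacent to `g₂H` iff `g₁⁻¹ * g₂ ∈ U`.  (When `HUH = U`, `H ∩ U = ∅` and
`U⁻¹ = U`, this matches the usual definition.) -/
def cosetGraph {G : Type*} [Group G] (H : Subgroup G) (U : Set G) :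
    SimpleGraph (G ⧸ H) :=
  SimpleGraph.fromRel fun x y =>
    ∃ g₁ g₂ : G, QuotientGroup.mk g₁ = x ∧ QuotientGroup.mk g₂ = y ∧ g₁⁻¹ * g₂ ∈ U

/-- `A` is a perfect code of the pair `(G,H)`: there is `U ⊆ G` with `HUH = U`,
`H ∩ U = ∅`, `U⁻¹ = U` such that `A/H = {aH : a ∈ A}` is a perfect code in the
coset graph `Cos(G,H,U)`. -/
def IsPerfectCodePair {G : Type*} [Group G] (H A : Subgroup G) : Prop :=
  ∃ U : Set G,
    (H : Set G) * U * (H : Set G) = U ∧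
    (H : Set G) ∩ U = ∅ ∧
    U⁻¹ = U ∧
    IsPerfectCode (cosetGraph H U) ((QuotientGroup.mk : G → G ⧸ H) '' (A : Set G))

/-- `A` is a total perfect code of the pair `(G,H)`. -/
def IsTotalPerfectCodePair {G : Type*} [Group G] (H A : Subgroup G) : Prop :=
  ∃ U : Set G,
    (H : Set G) * U * (H : Set G) = U ∧
    (H : Set G) ∩ U = ∅ ∧
    U⁻¹ = U ∧
    IsTotalPerfectCode (cosetGraph H U) ((QuotientGroup.mk : G → G ⧸ H) '' (A : Set G))

/-- A left transversal of `A` in `G`: a set containing exactly one element of each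
left coset of `A`. -/
def IsLeftTransversal {G : Type*} [Group G] (X : Set G) (A : Subgroup G) : Prop :=
  ∀ g : G, ∃! x, x ∈ X ∧ g⁻¹ * x ∈ A

/-- A right transversal of `A` in `G`: a set containing exactly one element of each
right coset of `A`. -/
def IsRightTransversal {G : Type*} [Group G] (Y : Set G) (A : Subgroup G) : Prop :=
  ∀ g : G, ∃! y, y ∈ Y ∧ y * g⁻¹ ∈ A

/-- When `U` is inverse-closed, disjoint from `H` and a union of `H`-double cosets, adjacency in
the coset graph can be read off from any coset representatives. -/
theorem cosetGraph_adj_mk {G : Type*} [Group G] {H : Subgroup G} {U : Set G}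
    (hU : (H : Set G) * U * (H : Set G) = U) (hHU : (H : Set G) ∩ U = ∅) (hinv : U⁻¹ = U)
    (g k : G) :
    (cosetGraph H U).Adj (QuotientGroup.mk g) (QuotientGroup.mk k) ↔ g⁻¹ * k ∈ U := by
  have key : ∀ g k g₁ g₂ : G, (QuotientGroup.mk g₁ : G ⧸ H) = QuotientGroup.mk g →
      (QuotientGroup.mk g₂ : G ⧸ H) = QuotientGroup.mk k → g₁⁻¹ * g₂ ∈ U → g⁻¹ * k ∈ U := by
    intro g k g₁ g₂ h₁ h₂ h
    rw [← hU]
    refine Set.mem_mul.2 ⟨(g⁻¹ * g₁) * (g₁⁻¹ * g₂), Set.mul_mem_mul ?_ h, g₂⁻¹ * k, ?_, by group⟩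
    · exact QuotientGroup.eq.1 h₁.symm
    · exact QuotientGroup.eq.1 h₂
  rw [cosetGraph, SimpleGraph.fromRel_adj]
  constructor
  · rintro ⟨-, ⟨g₁, g₂, h₁, h₂, h⟩ | ⟨g₁, g₂, h₁, h₂, h⟩⟩
    · exact key _ _ _ _ h₁ h₂ h
    · rw [← hinv, Set.mem_inv, mul_inv_rev, inv_inv]
      exact key _ _ _ _ h₁ h₂ h
  · intro h
    refine ⟨fun he => ?_, Or.inl ⟨g, k, rfl, rfl, h⟩⟩
    exact Set.eq_empty_iff_forall_notMem.1 hHU _ ⟨QuotientGroup.eq.1 he, h⟩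

/-- if `A ⊴ G`, `H ≤ A`, and `A` is a perfect code of `(G,H)`, then for
every `x ∈ G` with `x² ∈ A` there is `b ∈ A` with `(xb)² ∈ H`. -/
theorem perfectCodePair_normal_sq
    {G : Type*} [Group G] [Finite G] (H A : Subgroup G) [A.Normal] (hHA : H ≤ A)
    (h : IsPerfectCodePair H A) :
    ∀ x : G, x ^ 2 ∈ A → ∃ b ∈ A, (x * b) ^ 2 ∈ H := by
  intro x hx
  obtain ⟨U, hU, hHU, hinv, -, hcode⟩ := h
  by_cases hxA : x ∈ A
  · exact ⟨x⁻¹, A.inv_mem hxA, by simp⟩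
  have hx_notMem : (QuotientGroup.mk x : G ⧸ H) ∉
      (QuotientGroup.mk : G → G ⧸ H) '' (A : Set G) := by
    rintro ⟨a, ha, hax⟩
    exact hxA ((A.mul_mem_cancel_left (A.inv_mem ha)).1 (hHA (QuotientGroup.eq.1 hax)))
  obtain ⟨_, ⟨⟨a, ha, rfl⟩, hadj⟩, huniq⟩ := hcode _ hx_notMem
  rw [cosetGraph_adj_mk hU hHU hinv] at hadj
  have hconj : x⁻¹ * a⁻¹ * x ∈ A := by
    simpa using ‹A.Normal›.conj_mem a⁻¹ (A.inv_mem ha) x⁻¹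
  have hmem : x * a⁻¹ * x ∈ A := by
    have := A.mul_mem hx hconj
    rwa [show x ^ 2 * (x⁻¹ * a⁻¹ * x) = x * a⁻¹ * x by group] at this
  have heq := huniq (QuotientGroup.mk (x * a⁻¹ * x)) ⟨⟨_, hmem, rfl⟩, by
    rw [cosetGraph_adj_mk hU hHU hinv, ← hinv, Set.mem_inv]
    rwa [show (x⁻¹ * (x * a⁻¹ * x))⁻¹ = x⁻¹ * a by group]⟩
  refine ⟨x⁻¹ * a⁻¹ * x, hconj, ?_⟩
  have := QuotientGroup.eq.1 heq.symm
  rwa [show (x * (x⁻¹ * a⁻¹ * x)) ^ 2 = a⁻¹ * (x * a⁻¹ * x) by rw [sq]; group]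
end

section
/- Let G be a finite group with a normal subgroup K and a subgroup L such that G = KL and K ∩ L = {1}, and let H ≤ A ≤ L be subgroups. Then A is a total perfect code of the pair (G,H) if and only if A is a total perfect code of the pair (L,H). -/
open scoped Pointwise

theorem cosetGraph_adj_mk_iff {G : Type*} [Group G] {H : Subgroup G} {U : Set G}
    (hU : (H : Set G) * U * (H : Set G) = U) (hHU : (H : Set G) ∩ U = ∅) (hinv : U⁻¹ = U)
    (g₁ g₂ : G) :
    (cosetGraph H U).Adj (QuotientGroup.mk g₁) (QuotientGroup.mk g₂) ↔ g₁⁻¹ * g₂ ∈ U := by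
  have key : ∀ a b : G, (∃ x y : G, (QuotientGroup.mk x : G ⧸ H) = QuotientGroup.mk a ∧
      (QuotientGroup.mk y : G ⧸ H) = QuotientGroup.mk b ∧ x⁻¹ * y ∈ U) ↔ a⁻¹ * b ∈ U := by
    refine fun a b ↦ ⟨?_, fun h ↦ ⟨a, b, rfl, rfl, h⟩⟩
    rintro ⟨x, y, hx, hy, h⟩
    rw [← hU]
    have := Set.mul_mem_mul (Set.mul_mem_mul (QuotientGroup.eq.1 hx.symm) h)
      (QuotientGroup.eq.1 hy)
    simpa [mul_assoc] using this
  rw [cosetGraph, SimpleGraph.fromRel_adj, key, key]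
  constructor
  · rintro ⟨-, h | h⟩
    · exact h
    · rw [← hinv, Set.mem_inv]
      simpa using h
  · exact fun h ↦ ⟨fun he ↦ Set.eq_empty_iff_forall_notMem.1 hHU _
      ⟨QuotientGroup.eq.1 he, h⟩, Or.inl h⟩

theorem isTotalPerfectCode_cosetGraph_iff {G : Type*} [Group G] {H A : Subgroup G} {U : Set G}
    (hU : (H : Set G) * U * (H : Set G) = U) (hHU : (H : Set G) ∩ U = ∅) (hinv : U⁻¹ = U) :
    IsTotalPerfectCode (cosetGraph H U) ((QuotientGroup.mk : G → G ⧸ H) '' (A : Set G)) ↔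
      ∀ g : G, ∃ a ∈ A, g⁻¹ * a ∈ U ∧ ∀ b ∈ A, g⁻¹ * b ∈ U → b⁻¹ * a ∈ H := by
  rw [IsTotalPerfectCode, (QuotientGroup.mk_surjective (s := H)).forall]
  refine forall_congr' fun g ↦ ?_
  simp only [ExistsUnique, Set.mem_image, SetLike.mem_coe]
  constructor
  · rintro ⟨_, ⟨⟨a, ha, rfl⟩, hadj⟩, huniq⟩
    refine ⟨a, ha, (cosetGraph_adj_mk_iff hU hHU hinv _ _).1 hadj, fun b hb hgb ↦ ?_⟩
    exact QuotientGroup.eq.1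
      (huniq _ ⟨⟨b, hb, rfl⟩, (cosetGraph_adj_mk_iff hU hHU hinv _ _).2 hgb⟩)
  · rintro ⟨a, ha, hga, huniq⟩
    refine ⟨_, ⟨⟨a, ha, rfl⟩, (cosetGraph_adj_mk_iff hU hHU hinv _ _).2 hga⟩, ?_⟩
    rintro _ ⟨⟨b, hb, rfl⟩, hadj⟩
    exact QuotientGroup.eq.2 (huniq b hb ((cosetGraph_adj_mk_iff hU hHU hinv _ _).1 hadj))

theorem Subgroup.mul_mul_eq_self_iff {G : Type*} [Group G] (H : Subgroup G) (U : Set G) :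
    (H : Set G) * U * (H : Set G) = U ↔ ∀ h ∈ H, ∀ u ∈ U, ∀ k ∈ H, h * u * k ∈ U := by
  constructor
  · intro hU h hh u hu k hk
    rw [← hU]
    exact Set.mul_mem_mul (Set.mul_mem_mul hh hu) hk
  · intro hU
    refine Set.Subset.antisymm ?_ fun u hu ↦ ?_
    · rintro _ ⟨_, ⟨h, hh, u, hu, rfl⟩, k, hk, rfl⟩
      exact hU h hh u hu k hk
    · simpa using Set.mul_mem_mul (Set.mul_mem_mul H.one_mem hu) H.one_mem

/-- The defining conditions of a total perfect code pair, in terms of elements of the group. -/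
theorem isTotalPerfectCodePair_iff {G : Type*} [Group G] {H A : Subgroup G} :
    IsTotalPerfectCodePair H A ↔ ∃ U : Set G,
      (∀ h ∈ H, ∀ u ∈ U, ∀ k ∈ H, h * u * k ∈ U) ∧ (∀ h ∈ H, h ∉ U) ∧ (∀ u ∈ U, u⁻¹ ∈ U) ∧
      ∀ g : G, ∃ a ∈ A, g⁻¹ * a ∈ U ∧ ∀ b ∈ A, g⁻¹ * b ∈ U → b⁻¹ * a ∈ H := by
  refine exists_congr fun U ↦ ?_
  have hdisj : (H : Set G) ∩ U = ∅ ↔ ∀ h ∈ H, h ∉ U := by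
    simp [Set.eq_empty_iff_forall_notMem]
  have hinv : U⁻¹ = U ↔ ∀ u ∈ U, u⁻¹ ∈ U :=
    ⟨fun h u hu ↦ by rwa [← Set.mem_inv, h], fun h ↦ Set.ext fun u ↦
      ⟨fun hu ↦ by simpa using h _ hu, h u⟩⟩
  rw [← H.mul_mul_eq_self_iff, ← hdisj, ← hinv]
  exact and_congr_right fun h₁ ↦ and_congr_right fun h₂ ↦ and_congr_right fun h₃ ↦
    isTotalPerfectCode_cosetGraph_iff h₁ h₂ h₃

/-- A subgroup with a normal complement is a retract. -/
theorem Subgroup.exists_retraction_of_normal_complement {G : Type*} [Group G] (K L : Subgroup G)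
    [K.Normal] (hKL : (K : Set G) * (L : Set G) = Set.univ) (hKLbot : K ⊓ L = ⊥) :
    ∃ π : G →* L, ∀ l : L, π l = l := by
  have h := isComplement'_of_disjoint_and_mul_eq_univ (disjoint_iff.2 hKLbot) hKL
  exact ⟨h.symm.QuotientMulEquiv.toMonoidHom.comp (QuotientGroup.mk' K),
    fun l ↦ h.symm.QuotientMulEquiv.apply_symm_apply l⟩

theorem IsTotalPerfectCodePair.subgroupOf {G : Type*} [Group G] {H A L : Subgroup G}
    (hAL : A ≤ L) (h : IsTotalPerfectCodePair H A) :
    IsTotalPerfectCodePair (H.subgroupOf L) (A.subgroupOf L) := by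
  rw [isTotalPerfectCodePair_iff] at h ⊢
  obtain ⟨U, hU, hHU, hinv, hcode⟩ := h
  refine ⟨Subtype.val ⁻¹' U, fun h hh u hu k hk ↦ hU h hh u hu k hk, fun h hh ↦ hHU h hh,
    fun u hu ↦ hinv u hu, fun g ↦ ?_⟩
  obtain ⟨a, ha, hga, huniq⟩ := hcode g
  exact ⟨⟨a, hAL ha⟩, ha, hga, fun b hb hgb ↦ huniq b hb hgb⟩

theorem IsTotalPerfectCodePair.of_subgroupOf {G : Type*} [Group G] {H A L : Subgroup G}
    (hHA : H ≤ A) (hAL : A ≤ L) (π : G →* L) (hπ : ∀ l : L, π l = l)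
    (h : IsTotalPerfectCodePair (H.subgroupOf L) (A.subgroupOf L)) :
    IsTotalPerfectCodePair H A := by
  rw [isTotalPerfectCodePair_iff] at h ⊢
  obtain ⟨U, hU, hHU, hinv, hcode⟩ := h
  have hπ' : ∀ l (hl : l ∈ L), π l = ⟨l, hl⟩ := fun l hl ↦ hπ ⟨l, hl⟩
  have hHL := hHA.trans hAL
  refine ⟨π ⁻¹' U, fun h hh u hu k hk ↦ ?_, fun h hh ↦ ?_, fun u hu ↦ ?_, fun g ↦ ?_⟩
  · rw [Set.mem_preimage, map_mul, map_mul, hπ' h (hHL hh), hπ' k (hHL hk)]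
    exact hU _ hh _ hu _ hk
  · rw [Set.mem_preimage, hπ' h (hHL hh)]
    exact hHU _ hh
  · rw [Set.mem_preimage, map_inv]
    exact hinv _ hu
  · obtain ⟨a, ha, hga, huniq⟩ := hcode (π g)
    refine ⟨a, ha, ?_, fun b hb hgb ↦ ?_⟩
    · rwa [Set.mem_preimage, map_mul, map_inv, hπ]
    · rw [Set.mem_preimage, map_mul, map_inv, hπ' b (hAL hb)] at hgb
      exact huniq ⟨b, hAL hb⟩ hb hgb

/-- if `K ⊴ G`, `L ≤ G`, `G = KL`, `K ∩ L = 1` and `H ≤ A ≤ L`, then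
`A` is a total perfect code of `(G,H)` iff `A` is a total perfect code of `(L,H)`. -/
theorem totalPerfectCodePair_iff_of_complement
    {G : Type*} [Group G] [Finite G] (K L : Subgroup G) [K.Normal]
    (hKL : (K : Set G) * (L : Set G) = Set.univ) (hKLbot : K ⊓ L = ⊥)
    (H A : Subgroup G) (hHA : H ≤ A) (hAL : A ≤ L) :
    IsTotalPerfectCodePair H A ↔
      IsTotalPerfectCodePair (H.subgroupOf L) (A.subgroupOf L) := by
  obtain ⟨π, hπ⟩ := K.exists_retraction_of_normal_complement L hKL hKLbot
  exact ⟨fun h ↦ h.subgroupOf hAL, fun h ↦ h.of_subgroupOf hHA hAL π hπ⟩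
end
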